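/- Let w and v be classical solutions of the stiffness-only inextensible cantilever system with the same smooth forcing p, and suppose there is R > 0 such that for all (x,t) ∈ [0,L]×[0,T]: |∂_x^i w(x,t)| ≤ R and |∂_x^i v(x,t)| ≤ R for 0 ≤ i ≤ 3, and |∂_x^j w_t(x,t)| ≤ R and |∂_x^j v_t(x,t)| ≤ R for 0 ≤ j ≤ 2. Then there exists a constant C > 0, depending only on R, T, L and D, such that for z = w − v and all t ∈ [0,T]: ‖z_t(t)‖² + ‖z_xx(t)‖² ≤ C ( ‖z_t(0)‖² + ‖z_xx(0)‖² ). -/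

import Mathlib

open MeasureTheory Set

/-- Spatial partial derivative of a function of `(x, t)`. -/
noncomputable def pdx (f : ℝ → ℝ → ℝ) : ℝ → ℝ → ℝ := fun x t => deriv (fun y => f y t) x

/-- Temporal partial derivative of a function of `(x, t)`. -/
noncomputable def pdt (f : ℝ → ℝ → ℝ) : ℝ → ℝ → ℝ := fun x t => deriv (fun s => f x s) t

/-- The stiffness-only inextensible cantilever operator
`w_tt + D ∂ₓ⁴w - D ∂ₓ(w_xx² w_x) + D ∂ₓ²(w_x² w_xx)`. -/
noncomputable def stiffOp (D : ℝ) (w : ℝ → ℝ → ℝ) : ℝ → ℝ → ℝ := fun x t =>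
  pdt (pdt w) x t + D * pdx (pdx (pdx (pdx w))) x t
    - D * pdx (fun y s => (pdx (pdx w) y s) ^ 2 * pdx w y s) x t
    + D * pdx (pdx (fun y s => (pdx w y s) ^ 2 * pdx (pdx w) y s)) x t

/-- A classical solution of the stiffness-only inextensible cantilever system on
`[0,L] × [0,T]` with forcing `p`: smooth on an open neighborhood of `[0,L] × [0,T]`,
satisfying the PDE pointwise and the clamped-free boundary conditions. -/
def IsStiffSol (L D T : ℝ) (p w : ℝ → ℝ → ℝ) : Prop :=
  (∃ U : Set (ℝ × ℝ), IsOpen U ∧ Icc (0:ℝ) L ×ˢ Icc (0:ℝ) T ⊆ U ∧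
      ContDiffOn ℝ (⊤ : ℕ∞) (fun q : ℝ × ℝ => w q.1 q.2) U) ∧
  (∀ x ∈ Icc (0:ℝ) L, ∀ t ∈ Icc (0:ℝ) T, stiffOp D w x t = p x t) ∧
  (∀ t ∈ Icc (0:ℝ) T,
    w 0 t = 0 ∧ pdx w 0 t = 0 ∧ pdx (pdx w) L t = 0 ∧ pdx (pdx (pdx w)) L t = 0)


def SM (U : Set (ℝ × ℝ)) (f : ℝ → ℝ → ℝ) : Prop :=
  ContDiffOn ℝ (⊤ : ℕ∞) (fun q : ℝ × ℝ => f q.1 q.2) U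

section infra
variable {U : Set (ℝ × ℝ)} {f g : ℝ → ℝ → ℝ} {x t : ℝ}

lemma SM.hasFDerivAt (hU : IsOpen U) (hf : SM U f) (h : (x, t) ∈ U) :
    HasFDerivAt (fun q : ℝ × ℝ => f q.1 q.2) (fderiv ℝ (fun q : ℝ × ℝ => f q.1 q.2) (x, t)) (x, t) :=
  ((hf.contDiffAt (hU.mem_nhds h)).differentiableAt (by simp)).hasFDerivAt

lemma SM.hx0 (hU : IsOpen U) (hf : SM U f) (h : (x, t) ∈ U) :
    HasDerivAt (fun y => f y t) (fderiv ℝ (fun q : ℝ × ℝ => f q.1 q.2) (x, t) (1, 0)) x := by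
  have h1 := hf.hasFDerivAt hU h
  have h2 : HasDerivAt (fun y : ℝ => (y, t)) ((1 : ℝ), (0 : ℝ)) x :=
    (hasDerivAt_id x).prodMk (hasDerivAt_const x t)
  exact h1.comp_hasDerivAt (f := fun y : ℝ => (y, t)) x h2

lemma SM.ht0 (hU : IsOpen U) (hf : SM U f) (h : (x, t) ∈ U) :
    HasDerivAt (fun s => f x s) (fderiv ℝ (fun q : ℝ × ℝ => f q.1 q.2) (x, t) (0, 1)) t := by
  have h1 := hf.hasFDerivAt hU h
  have h2 : HasDerivAt (fun y : ℝ => (x, y)) ((0 : ℝ), (1 : ℝ)) t :=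
    (hasDerivAt_const t x).prodMk (hasDerivAt_id t)
  exact h1.comp_hasDerivAt (f := fun y : ℝ => (x, y)) t h2

lemma SM.pdx_eq (hU : IsOpen U) (hf : SM U f) (h : (x, t) ∈ U) :
    pdx f x t = fderiv ℝ (fun q : ℝ × ℝ => f q.1 q.2) (x, t) (1, 0) := (hf.hx0 hU h).deriv

lemma SM.pdt_eq (hU : IsOpen U) (hf : SM U f) (h : (x, t) ∈ U) :
    pdt f x t = fderiv ℝ (fun q : ℝ × ℝ => f q.1 q.2) (x, t) (0, 1) := (hf.ht0 hU h).deriv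

lemma SM.hx (hU : IsOpen U) (hf : SM U f) (h : (x, t) ∈ U) :
    HasDerivAt (fun y => f y t) (pdx f x t) x := by
  rw [hf.pdx_eq hU h]; exact hf.hx0 hU h

lemma SM.ht (hU : IsOpen U) (hf : SM U f) (h : (x, t) ∈ U) :
    HasDerivAt (fun s => f x s) (pdt f x t) t := by
  rw [hf.pdt_eq hU h]; exact hf.ht0 hU h

lemma SM.pdx (hU : IsOpen U) (hf : SM U f) : SM U (pdx f) := by
  have h1 : ContDiffOn ℝ (⊤ : ℕ∞) (fderiv ℝ (fun q : ℝ × ℝ => f q.1 q.2)) U :=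
    ContDiffOn.fderiv_of_isOpen hf hU (by simp)
  have h2 := h1.clm_apply (contDiffOn_const (c := ((1 : ℝ), (0 : ℝ))))
  exact h2.congr fun q hq => hf.pdx_eq hU hq

lemma SM.pdt (hU : IsOpen U) (hf : SM U f) : SM U (pdt f) := by
  have h1 : ContDiffOn ℝ (⊤ : ℕ∞) (fderiv ℝ (fun q : ℝ × ℝ => f q.1 q.2)) U :=
    ContDiffOn.fderiv_of_isOpen hf hU (by simp)
  have h2 := h1.clm_apply (contDiffOn_const (c := ((0 : ℝ), (1 : ℝ))))
  exact h2.congr fun q hq => hf.pdt_eq hU hq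

lemma pdx_congr (hU : IsOpen U) (hfg : ∀ q ∈ U, f q.1 q.2 = g q.1 q.2) (h : (x, t) ∈ U) :
    pdx f x t = pdx g x t := by
  apply Filter.EventuallyEq.deriv_eq
  have : ∀ᶠ y in nhds x, (y, t) ∈ U :=
    (Continuous.continuousAt (by fun_prop : Continuous fun y : ℝ => (y, t))).eventually
      (hU.mem_nhds h)
  filter_upwards [this] with y hy using hfg _ hy

lemma pdt_congr (hU : IsOpen U) (hfg : ∀ q ∈ U, f q.1 q.2 = g q.1 q.2) (h : (x, t) ∈ U) :
    pdt f x t = pdt g x t := by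
  apply Filter.EventuallyEq.deriv_eq
  have : ∀ᶠ y in nhds t, (x, y) ∈ U :=
    (Continuous.continuousAt (by fun_prop : Continuous fun y : ℝ => (x, y))).eventually
      (hU.mem_nhds h)
  filter_upwards [this] with y hy using hfg _ hy

lemma SM.comm (hU : IsOpen U) (hf : SM U f) (h : (x, t) ∈ U) :
    _root_.pdt (_root_.pdx f) x t = _root_.pdx (_root_.pdt f) x t := by
  set F := fun q : ℝ × ℝ => f q.1 q.2 with hF
  have h1 : ContDiffOn ℝ (⊤ : ℕ∞) (fderiv ℝ F) U :=
    ContDiffOn.fderiv_of_isOpen hf hU (by simp)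
  have hd : HasFDerivAt (fderiv ℝ F) (fderiv ℝ (fderiv ℝ F) (x, t)) (x, t) :=
    ((h1.contDiffAt (hU.mem_nhds h)).differentiableAt (by simp)).hasFDerivAt
  have sym : IsSymmSndFDerivAt ℝ F (x, t) :=
    (ContDiffOn.contDiffAt hf (hU.mem_nhds h)).isSymmSndFDerivAt (by simp; exact WithTop.coe_le_coe.2 le_top)
  rw [pdt_congr hU (g := fun a b => fderiv ℝ F (a, b) (1, 0)) (fun q hq => hf.pdx_eq hU hq) h,
    pdx_congr hU (g := fun a b => fderiv ℝ F (a, b) (0, 1)) (fun q hq => hf.pdt_eq hU hq) h]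
  have h2 : HasDerivAt (fun y : ℝ => (x, y)) ((0 : ℝ), (1 : ℝ)) t :=
    (hasDerivAt_const t x).prodMk (hasDerivAt_id t)
  have h3 : HasDerivAt (fun y : ℝ => (y, t)) ((1 : ℝ), (0 : ℝ)) x :=
    (hasDerivAt_id x).prodMk (hasDerivAt_const x t)
  have e1 := (hd.comp_hasDerivAt (f := fun y : ℝ => (x, y)) t h2).clm_apply
    (hasDerivAt_const t ((1 : ℝ), (0 : ℝ)))
  have e2 := (hd.comp_hasDerivAt (f := fun y : ℝ => (y, t)) x h3).clm_apply
    (hasDerivAt_const x ((0 : ℝ), (1 : ℝ)))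
  have e1' := e1.deriv
  have e2' := e2.deriv
  simp only [map_zero, add_zero, Function.comp_apply] at e1' e2'
  unfold _root_.pdt _root_.pdx
  rw [e1', e2']
  exact sym _ _

lemma SM.contx (hf : SM U f) {L : ℝ} (h : ∀ x ∈ Icc (0 : ℝ) L, (x, t) ∈ U) :
    ContinuousOn (fun y => f y t) (Icc 0 L) := by
  have := ContDiffOn.continuousOn hf
  exact this.comp (f := fun y : ℝ => (y, t)) (by fun_prop) h

lemma SM.leibniz (hU : IsOpen U) (hf : SM U f) {L : ℝ} (hL : 0 < L)
    (h : ∀ x ∈ Icc (0 : ℝ) L, (x, t) ∈ U) :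
    HasDerivAt (fun s => ∫ x in (0 : ℝ)..L, f x s) (∫ x in (0 : ℝ)..L, _root_.pdt f x t) t := by
  obtain ⟨V, W, hV, hW, hIV, htW, hVW⟩ := generalized_tube_lemma (isCompact_Icc (a := (0 : ℝ)) (b := L))
    (isCompact_singleton (x := t)) hU (by rintro ⟨a, b⟩ ⟨h1, h2⟩; simp at h2; subst h2; exact h a h1)
  obtain ⟨δ, hδ, hδW⟩ := Metric.nhds_basis_closedBall.mem_iff.1
    (hW.mem_nhds (htW (mem_singleton t)))
  have hin : ∀ a ∈ Icc (0 : ℝ) L, ∀ s ∈ Metric.closedBall t δ, (a, s) ∈ U :=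
    fun a ha s hs => hVW ⟨hIV ha, hδW hs⟩
  have hc : ContinuousOn (fun q : ℝ × ℝ => _root_.pdt f q.1 q.2)
      (Icc (0 : ℝ) L ×ˢ Metric.closedBall t δ) :=
    (ContDiffOn.continuousOn (hf.pdt hU)).mono fun q hq => hin _ hq.1 _ hq.2
  obtain ⟨M, hM⟩ := (isCompact_Icc.prod (isCompact_closedBall t δ)).exists_bound_of_continuousOn hc
  have hsub : uIoc (0 : ℝ) L ⊆ Icc 0 L := by rw [uIoc_of_le hL.le]; exact Ioc_subset_Icc_self
  have hmeas : ∀ g : ℝ → ℝ, ContinuousOn g (Icc 0 L) →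
      AEStronglyMeasurable g (volume.restrict (uIoc (0 : ℝ) L)) := fun g hg =>
    (hg.mono hsub).aestronglyMeasurable measurableSet_uIoc
  refine (intervalIntegral.hasDerivAt_integral_of_dominated_loc_of_deriv_le
    (F := fun s x => f x s) (F' := fun s x => _root_.pdt f x s) (bound := fun _ => M)
    (Metric.closedBall_mem_nhds t hδ) ?_ ?_ ?_ ?_ ?_ ?_).2
  · filter_upwards [Metric.closedBall_mem_nhds t hδ] with s hs
    exact hmeas _ (hf.contx fun a ha => hin a ha s hs)
  · exact (by simpa [uIcc_of_le hL.le] using hf.contx h : ContinuousOn _ (uIcc 0 L)).intervalIntegrable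
  · exact hmeas _ ((hf.pdt hU).contx h)
  · exact Filter.Eventually.of_forall fun a ha s hs => hM (a, s) ⟨hsub ha, hs⟩
  · simp
  · exact Filter.Eventually.of_forall fun a ha s hs => hf.ht hU (hin a (hsub ha) s hs)

end infra

section oned
variable {L : ℝ}

lemma ii (hL : 0 < L) {g : ℝ → ℝ} (hg : ContinuousOn g (Icc 0 L)) :
    IntervalIntegrable g volume 0 L := by
  rw [← uIcc_of_le hL.le] at hg; exact hg.intervalIntegrable

lemma ftc (hL : 0 < L) {F F' : ℝ → ℝ} (h : ∀ x ∈ Icc (0 : ℝ) L, HasDerivAt F (F' x) x)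
    (hc : ContinuousOn F' (Icc 0 L)) : ∫ x in (0 : ℝ)..L, F' x = F L - F 0 :=
  intervalIntegral.integral_eq_sub_of_hasDerivAt (by rwa [uIcc_of_le hL.le]) (ii hL hc)

lemma mono2 (hL : 0 < L) {F a b : ℝ → ℝ} (α β : ℝ) (hF : ContinuousOn F (Icc 0 L))
    (ha : ContinuousOn a (Icc 0 L)) (hb : ContinuousOn b (Icc 0 L))
    (h : ∀ x ∈ Icc (0 : ℝ) L, F x ≤ α * a x + β * b x) :
    ∫ x in (0 : ℝ)..L, F x ≤ α * (∫ x in (0 : ℝ)..L, a x) + β * ∫ x in (0 : ℝ)..L, b x := by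
  rw [← intervalIntegral.integral_const_mul, ← intervalIntegral.integral_const_mul,
    ← intervalIntegral.integral_add (ii hL (by fun_prop)) (ii hL (by fun_prop))]
  exact intervalIntegral.integral_mono_on hL.le (ii hL hF) (ii hL (by fun_prop)) h

lemma poincare (hL : 0 < L) {f f' : ℝ → ℝ} (h : ∀ x ∈ Icc (0 : ℝ) L, HasDerivAt f (f' x) x)
    (hc : ContinuousOn f' (Icc 0 L)) (h0 : f 0 = 0) :
    ∫ x in (0 : ℝ)..L, f x ^ 2 ≤ 4 * L ^ 2 * ∫ x in (0 : ℝ)..L, f' x ^ 2 := by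
  have hf : ContinuousOn f (Icc 0 L) := fun x hx => (h x hx).continuousAt.continuousWithinAt
  have h1 := ftc hL (F := fun x => (x - L) * f x ^ 2)
    (F' := fun x => f x ^ 2 + 2 * (x - L) * f x * f' x)
    (fun x hx => by
      refine (((hasDerivAt_id x).sub_const L).fun_mul ((h x hx).fun_pow 2)).congr_deriv ?_
      simp; ring) (by fun_prop)
  have h2 := mono2 hL (F := fun x => - (2 * (x - L) * f x * f' x)) (1/2) (2 * L ^ 2)
    (a := fun x => f x ^ 2) (b := fun x => f' x ^ 2) (by fun_prop) (by fun_prop) (by fun_prop)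
    (fun x hx => by
      have : (x - L) ^ 2 ≤ L ^ 2 := by nlinarith [hx.1, hx.2]
      nlinarith [sq_nonneg (f x + 2 * (x - L) * f' x), mul_le_mul_of_nonneg_right this (sq_nonneg (f' x))])
  rw [intervalIntegral.integral_add (ii hL (by fun_prop)) (ii hL (by fun_prop))] at h1
  rw [intervalIntegral.integral_neg] at h2
  simp [h0] at h1
  linarith

lemma interp (hL : 0 < L) {ε : ℝ} (hε : 0 < ε) : ∃ M : ℝ, 0 ≤ M ∧ ∀ f f1 f2 : ℝ → ℝ,
    (∀ x ∈ Icc (0 : ℝ) L, HasDerivAt f (f1 x) x) → (∀ x ∈ Icc (0 : ℝ) L, HasDerivAt f1 (f2 x) x) →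
    ContinuousOn f2 (Icc 0 L) → f 0 = 0 → f1 0 = 0 →
    ∫ x in (0 : ℝ)..L, f1 x ^ 2 ≤
      ε * (∫ x in (0 : ℝ)..L, f2 x ^ 2) + M * ∫ x in (0 : ℝ)..L, f x ^ 2 := by
  obtain ⟨η, hη, hη1, hη2⟩ : ∃ η : ℝ, 0 < η ∧ η ≤ 1/2 ∧ η ≤ ε/2 :=
    ⟨min (1/2) (ε/2), by positivity, min_le_left _ _, min_le_right _ _⟩
  refine ⟨1/η^3 + 1/η, by positivity, ?_⟩
  intro f f1 f2 h h1 hc2 h0 h10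
  have hc : ContinuousOn f (Icc 0 L) := fun x hx => (h x hx).continuousAt.continuousWithinAt
  have hc1 : ContinuousOn f1 (Icc 0 L) := fun x hx => (h1 x hx).continuousAt.continuousWithinAt
  have a1 := ftc hL (F := fun x => f x ^ 2) (F' := fun x => 2 * f x * f1 x)
    (fun x hx => ((h x hx).fun_pow 2).congr_deriv (by simp)) (by fun_prop)
  have a2 := ftc hL (F := fun x => f1 x ^ 2) (F' := fun x => 2 * f1 x * f2 x)
    (fun x hx => ((h1 x hx).fun_pow 2).congr_deriv (by simp)) (by fun_prop)
  have a3 := ftc hL (F := fun x => f x * f1 x) (F' := fun x => f1 x ^ 2 + f x * f2 x)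
    (fun x hx => ((h x hx).fun_mul (h1 x hx)).congr_deriv (by ring)) (by fun_prop)
  rw [intervalIntegral.integral_add (ii hL (by fun_prop)) (ii hL (by fun_prop))] at a3
  have b1 := mono2 hL (F := fun x => 2 * f x * f1 x) (1/η^2) (η^2)
    (a := fun x => f x ^ 2) (b := fun x => f1 x ^ 2) (by fun_prop) (by fun_prop) (by fun_prop)
    (fun x hx => by
      have : 0 ≤ (f x / η - η * f1 x) ^ 2 := sq_nonneg _
      have e : (f x / η - η * f1 x) ^ 2 = 1/η^2 * f x ^ 2 + η^2 * f1 x ^ 2 - 2 * f x * f1 x := by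
        field_simp; ring
      linarith)
  have b2 := mono2 hL (F := fun x => 2 * f1 x * f2 x) 1 1
    (a := fun x => f1 x ^ 2) (b := fun x => f2 x ^ 2) (by fun_prop) (by fun_prop) (by fun_prop)
    (fun x hx => by nlinarith [sq_nonneg (f1 x - f2 x)])
  have b3 := mono2 hL (F := fun x => - (f x * f2 x)) (1/(2*η)) (η/2)
    (a := fun x => f x ^ 2) (b := fun x => f2 x ^ 2) (by fun_prop) (by fun_prop) (by fun_prop)
    (fun x hx => by
      have : 0 ≤ 1/(2*η) * (f x + η * f2 x) ^ 2 := by positivity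
      have e : 1/(2*η) * (f x + η * f2 x) ^ 2 = 1/(2*η) * f x ^ 2 + η/2 * f2 x ^ 2 + f x * f2 x := by
        field_simp; ring
      linarith)
  rw [intervalIntegral.integral_neg] at b3
  rw [a1] at b1
  rw [a2] at b2
  have pa : 0 ≤ ∫ x in (0 : ℝ)..L, f x ^ 2 :=
    intervalIntegral.integral_nonneg hL.le fun x _ => sq_nonneg _
  have pb : 0 ≤ ∫ x in (0 : ℝ)..L, f1 x ^ 2 :=
    intervalIntegral.integral_nonneg hL.le fun x _ => sq_nonneg _
  have pc : 0 ≤ ∫ x in (0 : ℝ)..L, f2 x ^ 2 :=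
    intervalIntegral.integral_nonneg hL.le fun x _ => sq_nonneg _
  set a := ∫ x in (0 : ℝ)..L, f x ^ 2
  set b := ∫ x in (0 : ℝ)..L, f1 x ^ 2
  set c := ∫ x in (0 : ℝ)..L, f2 x ^ 2
  set k := ∫ x in (0 : ℝ)..L, f x * f2 x
  simp only [h0, h10] at a3 b1 b2
  have e : f L * f1 L ≤ η/2 * (f1 L)^2 + 1/(2*η) * (f L)^2 := by
    have : 0 ≤ 1/(2*η) * (f L - η * f1 L) ^ 2 := by positivity
    have e : 1/(2*η) * (f L - η * f1 L) ^ 2 = η/2 * (f1 L)^2 + 1/(2*η) * (f L)^2 - f L * f1 L := by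
      field_simp; ring
    linarith
  have e1 : η/2 * (f1 L)^2 ≤ η/2 * (b + c) := by
    apply mul_le_mul_of_nonneg_left _ (by positivity); linarith
  have e2 : 1/(2*η) * (f L)^2 ≤ 1/(2*η) * (1/η^2 * a + η^2 * b) := by
    apply mul_le_mul_of_nonneg_left _ (by positivity); linarith
  have e3 : 1/(2*η) * (1/η^2 * a + η^2 * b) = 1/2 * (1/η^3) * a + η/2 * b := by
    field_simp
  have e4 : 1/(2*η) * a = 1/2 * (1/η) * a := by field_simp
  have e5 : η * b ≤ 1/2 * b := mul_le_mul_of_nonneg_right hη1 pb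
  have e6 : η * c ≤ ε/2 * c := mul_le_mul_of_nonneg_right hη2 pc
  linarith
end oned

section algebra

lemma kxy {k K x y : ℝ} (h : |k| ≤ K) : k * (x * y) ≤ K / 2 * (x ^ 2 + y ^ 2) := by
  have h1 := abs_le.1 h
  nlinarith [mul_nonneg (sub_nonneg.2 h1.2) (sq_nonneg (x + y)),
    mul_nonneg (by linarith [h1.1] : (0 : ℝ) ≤ K + k) (sq_nonneg (x - y))]

lemma abs_mul_le2 {a b A B : ℝ} (ha : |a| ≤ A) (hb : |b| ≤ B) : |a * b| ≤ A * B := by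
  rw [abs_mul]
  exact mul_le_mul ha hb (abs_nonneg _) ((abs_nonneg _).trans ha)

lemma abs_add_le2 {a b A B : ℝ} (ha : |a| ≤ A) (hb : |b| ≤ B) : |a + b| ≤ A + B :=
  (abs_add_le a b).trans (add_le_add ha hb)

lemma abs_sub_le2 {a b A B : ℝ} (ha : |a| ≤ A) (hb : |b| ≤ B) : |a - b| ≤ A + B := by
  rw [sub_eq_add_neg]; exact abs_add_le2 ha (by rwa [abs_neg])

lemma rest_bound {D R lam w1 v1 w2 v2 w1t v1t w2t v2t z zt : ℝ} (hD : 0 < D) (hlam : 0 ≤ lam)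
    (h1 : |w1| ≤ R) (h2 : |v1| ≤ R) (h3 : |w2| ≤ R) (h4 : |v2| ≤ R)
    (h5 : |w1t| ≤ R) (h6 : |v1t| ≤ R) (h7 : |w2t| ≤ R) (h8 : |v2t| ≤ R) :
    lam * z * zt + D * (w1 * w1t * (w2 - v2) ^ 2
      + ((w1t + v1t) * v2 + (w1 + v1) * v2t) * (w1 - v1) * (w2 - v2)
      + (v1 * v2 - w1 * w2) * (w2 - v2) * (w1t - v1t) + v2 * v2t * (w1 - v1) ^ 2) ≤
    lam / 2 * z ^ 2 + lam / 2 * zt ^ 2 + 6 * D * R ^ 2 * (w1 - v1) ^ 2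
      + 6 * D * R ^ 2 * (w2 - v2) ^ 2 := by
  have k1 := kxy (x := w2 - v2) (y := w2 - v2) (abs_mul_le2 h1 h5)
  have k2 := kxy (x := w1 - v1) (y := w2 - v2)
    (abs_add_le2 (abs_mul_le2 (abs_add_le2 h5 h6) h4) (abs_mul_le2 (abs_add_le2 h1 h2) h8))
  have k3 := kxy (x := w2 - v2) (y := w2 - v2)
    (abs_mul_le2 (a := -w1) (A := R) (by rwa [abs_neg]) (abs_sub_le2 h5 h6))
  have k4 := kxy (x := w1 - v1) (y := w2 - v2)
    (abs_mul_le2 (a := -v2) (A := R) (by rwa [abs_neg]) (abs_sub_le2 h5 h6))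
  have k5 := kxy (x := w1 - v1) (y := w1 - v1) (abs_mul_le2 h4 h8)
  have k6 : lam * z * zt ≤ lam / 2 * z ^ 2 + lam / 2 * zt ^ 2 := by
    nlinarith [mul_nonneg hlam (sq_nonneg (z - zt))]
  have k7 : w1 * w1t * (w2 - v2) ^ 2
      + ((w1t + v1t) * v2 + (w1 + v1) * v2t) * (w1 - v1) * (w2 - v2)
      + (v1 * v2 - w1 * w2) * (w2 - v2) * (w1t - v1t) + v2 * v2t * (w1 - v1) ^ 2
      ≤ 6 * R ^ 2 * (w1 - v1) ^ 2 + 6 * R ^ 2 * (w2 - v2) ^ 2 := by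
    have : 0 ≤ 2 * R ^ 2 * (w1 - v1) ^ 2 := by positivity
    linarith
  have := mul_le_mul_of_nonneg_left k7 hD.le
  linarith

lemma lower_bound {D R lam w1 v1 w2 v2 z zt : ℝ} (hD : 0 < D)
    (h1 : |w1| ≤ R) (h2 : |v1| ≤ R) (h4 : |v2| ≤ R) :
    -(1 / 2 * zt ^ 2 + D / 2 * (1 + w1 ^ 2) * (w2 - v2) ^ 2
      + D * ((w1 + v1) * v2 * (w1 - v1) * (w2 - v2)) + D / 2 * (v2 ^ 2 * (w1 - v1) ^ 2)
      + lam / 2 * z ^ 2) ≤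
    -(lam / 2) * z ^ 2 + (-(1 / 2)) * zt ^ 2 + 4 * D * R ^ 4 * (w1 - v1) ^ 2
      + (-(D / 4)) * (w2 - v2) ^ 2 := by
  have k := kxy (x := 2 * R ^ 2 * (w1 - v1)) (y := 1 / 2 * (w2 - v2)) (k := -1) (K := 1) (by simp)
  have hR : 0 ≤ R := (abs_nonneg _).trans h1
  have hk : |(w1 + v1) * v2| ≤ 2 * R ^ 2 := by
    have := abs_mul_le2 (abs_add_le2 h1 h2) h4
    linarith
  have k2 : |(w1 + v1) * v2 * (w1 - v1) * (w2 - v2)| ≤ 2 * R ^ 2 * |(w1 - v1) * (w2 - v2)| := by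
    rw [mul_assoc, abs_mul]
    exact mul_le_mul_of_nonneg_right hk (abs_nonneg _)
  have k3 : 2 * R ^ 2 * |(w1 - v1) * (w2 - v2)| ≤ 4 * R ^ 4 * (w1 - v1) ^ 2 + 1 / 4 * (w2 - v2) ^ 2 := by
    rw [abs_mul, ← sq_abs (w1 - v1), ← sq_abs (w2 - v2)]
    nlinarith [sq_nonneg (2 * R ^ 2 * |w1 - v1| - 1 / 2 * |w2 - v2|)]
  have k4 := neg_abs_le ((w1 + v1) * v2 * (w1 - v1) * (w2 - v2))
  have k5 : -((w1 + v1) * v2 * (w1 - v1) * (w2 - v2)) ≤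
      4 * R ^ 4 * (w1 - v1) ^ 2 + 1 / 4 * (w2 - v2) ^ 2 := by linarith
  have k6 := mul_le_mul_of_nonneg_left k5 hD.le
  have p1 : 0 ≤ D / 2 * w1 ^ 2 * (w2 - v2) ^ 2 := by positivity
  have p2 : 0 ≤ D / 2 * (v2 ^ 2 * (w1 - v1) ^ 2) := by positivity
  linarith

lemma upper_bound {D R lam w1 v1 w2 v2 z zt : ℝ} (hD : 0 < D)
    (h1 : |w1| ≤ R) (h2 : |v1| ≤ R) (h4 : |v2| ≤ R) :
    (1 / 2 * zt ^ 2 + D / 2 * (1 + w1 ^ 2) * (w2 - v2) ^ 2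
      + D * ((w1 + v1) * v2 * (w1 - v1) * (w2 - v2)) + D / 2 * (v2 ^ 2 * (w1 - v1) ^ 2)
      + lam / 2 * z ^ 2) ≤
    (lam / 2) * z ^ 2 + (1 / 2) * zt ^ 2 + 3 / 2 * D * R ^ 2 * (w1 - v1) ^ 2
      + (D / 2 * (1 + 3 * R ^ 2)) * (w2 - v2) ^ 2 := by
  have k1 := kxy (x := w2 - v2) (y := w2 - v2) (abs_mul_le2 h1 h1)
  have k2 := kxy (x := w1 - v1) (y := w2 - v2) (abs_mul_le2 (abs_add_le2 h1 h2) h4)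
  have k3 := kxy (x := w1 - v1) (y := w1 - v1) (abs_mul_le2 h4 h4)
  have := mul_le_mul_of_nonneg_left k1 hD.le
  have := mul_le_mul_of_nonneg_left k2 hD.le
  have := mul_le_mul_of_nonneg_left k3 hD.le
  linarith

end algebra

section oned2
variable {L : ℝ}

lemma mono4 (hL : 0 < L) {F a b c d : ℝ → ℝ} (α β γ δ : ℝ) (hF : ContinuousOn F (Icc 0 L))
    (ha : ContinuousOn a (Icc 0 L)) (hb : ContinuousOn b (Icc 0 L))
    (hc : ContinuousOn c (Icc 0 L)) (hd : ContinuousOn d (Icc 0 L))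
    (h : ∀ x ∈ Icc (0 : ℝ) L, F x ≤ α * a x ^ 2 + β * b x ^ 2 + γ * c x ^ 2 + δ * d x ^ 2) :
    ∫ x in (0 : ℝ)..L, F x ≤ α * (∫ x in (0 : ℝ)..L, a x ^ 2) + β * (∫ x in (0 : ℝ)..L, b x ^ 2)
      + γ * (∫ x in (0 : ℝ)..L, c x ^ 2) + δ * (∫ x in (0 : ℝ)..L, d x ^ 2) := by
  have h1 := mono2 hL (F := F) 1 1 (a := fun x => α * a x ^ 2 + β * b x ^ 2)
    (b := fun x => γ * c x ^ 2 + δ * d x ^ 2) hF (by fun_prop) (by fun_prop)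
    (fun x hx => by linarith [h x hx])
  have h2 := mono2 hL (F := fun x => α * a x ^ 2 + β * b x ^ 2) α β (a := fun x => a x ^ 2)
    (b := fun x => b x ^ 2) (by fun_prop) (by fun_prop) (by fun_prop) (fun x hx => le_rfl)
  have h3 := mono2 hL (F := fun x => γ * c x ^ 2 + δ * d x ^ 2) γ δ (a := fun x => c x ^ 2)
    (b := fun x => d x ^ 2) (by fun_prop) (by fun_prop) (by fun_prop) (fun x hx => le_rfl)
  linarith

lemma flux1D (hL : 0 < L) {D : ℝ} {A A1 A2 B B1 φ φ1 φ2 q : ℝ → ℝ}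
    (hA : ∀ x ∈ Icc (0 : ℝ) L, HasDerivAt A (A1 x) x)
    (hA1 : ∀ x ∈ Icc (0 : ℝ) L, HasDerivAt A1 (A2 x) x)
    (hB : ∀ x ∈ Icc (0 : ℝ) L, HasDerivAt B (B1 x) x)
    (hφ : ∀ x ∈ Icc (0 : ℝ) L, HasDerivAt φ (φ1 x) x)
    (hφ1 : ∀ x ∈ Icc (0 : ℝ) L, HasDerivAt φ1 (φ2 x) x)
    (cφ2 : ContinuousOn φ2 (Icc 0 L)) (cq : ContinuousOn q (Icc 0 L))
    (heq : ∀ x ∈ Icc (0 : ℝ) L, q x + D * A2 x - D * B1 x = 0)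
    (hφ0 : φ 0 = 0) (hφ10 : φ1 0 = 0) (hAL : A L = 0) (hA1L : A1 L = 0) (hBL : B L = 0) :
    ContinuousOn (fun x => q x * φ x + D * (A x * φ2 x) + D * (B x * φ1 x)) (Icc 0 L) ∧
    ∫ x in (0 : ℝ)..L, (q x * φ x + D * (A x * φ2 x) + D * (B x * φ1 x)) = 0 := by
  have cA : ContinuousOn A (Icc 0 L) := fun x hx => (hA x hx).continuousAt.continuousWithinAt
  have cA1 : ContinuousOn A1 (Icc 0 L) := fun x hx => (hA1 x hx).continuousAt.continuousWithinAt
  have cB : ContinuousOn B (Icc 0 L) := fun x hx => (hB x hx).continuousAt.continuousWithinAt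
  have cφ : ContinuousOn φ (Icc 0 L) := fun x hx => (hφ x hx).continuousAt.continuousWithinAt
  have cφ1 : ContinuousOn φ1 (Icc 0 L) := fun x hx => (hφ1 x hx).continuousAt.continuousWithinAt
  have hc : ContinuousOn (fun x => q x * φ x + D * (A x * φ2 x) + D * (B x * φ1 x)) (Icc 0 L) := by
    fun_prop
  refine ⟨hc, ?_⟩
  rw [ftc hL (F := fun x => D * (A x * φ1 x - A1 x * φ x + B x * φ x)) _ hc]
  · simp [hφ0, hφ10, hAL, hA1L, hBL]
  · intro x hx
    refine (((((hA x hx).fun_mul (hφ1 x hx)).fun_sub ((hA1 x hx).fun_mul (hφ x hx))).fun_add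
      ((hB x hx).fun_mul (hφ x hx))).const_mul D).congr_deriv ?_
    linear_combination (- φ x) * heq x hx
end oned2

section energy
variable {U : Set (ℝ × ℝ)} {f g : ℝ → ℝ → ℝ} {x t : ℝ}

lemma SM.add (hf : SM U f) (hg : SM U g) : SM U (fun x t => f x t + g x t) := ContDiffOn.add hf hg
lemma SM.sub (hf : SM U f) (hg : SM U g) : SM U (fun x t => f x t - g x t) := ContDiffOn.sub hf hg
lemma SM.mul (hf : SM U f) (hg : SM U g) : SM U (fun x t => f x t * g x t) := ContDiffOn.mul hf hg
lemma SM.pow (hf : SM U f) (n : ℕ) : SM U (fun x t => f x t ^ n) := ContDiffOn.pow hf n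
lemma SM.const (c : ℝ) : SM U (fun _ _ => c) := contDiffOn_const

noncomputable def En (D lam : ℝ) (w v : ℝ → ℝ → ℝ) : ℝ → ℝ → ℝ := fun x t =>
  1 / 2 * (pdt w x t - pdt v x t) ^ 2
    + D / 2 * (1 + pdx w x t ^ 2) * (pdx (pdx w) x t - pdx (pdx v) x t) ^ 2
    + D * ((pdx w x t + pdx v x t) * pdx (pdx v) x t * (pdx w x t - pdx v x t)
        * (pdx (pdx w) x t - pdx (pdx v) x t))
    + D / 2 * (pdx (pdx v) x t ^ 2 * (pdx w x t - pdx v x t) ^ 2)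
    + lam / 2 * (w x t - v x t) ^ 2

variable {w v : ℝ → ℝ → ℝ} {D lam : ℝ}

lemma En_SM (hU : IsOpen U) (hw : SM U w) (hv : SM U v) : SM U (En D lam w v) := by
  have w1 := hw.pdx hU
  have v1 := hv.pdx hU
  have w2 := w1.pdx hU
  have v2 := v1.pdx hU
  have wt := hw.pdt hU
  have vt := hv.pdt hU
  exact (((((SM.const _).mul ((wt.sub vt).pow 2)).add
    (((SM.const _).mul ((SM.const _).add (w1.pow 2))).mul ((w2.sub v2).pow 2))).add
    ((SM.const _).mul ((((w1.add v1).mul v2).mul (w1.sub v1)).mul (w2.sub v2)))).add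
    ((SM.const _).mul ((v2.pow 2).mul ((w1.sub v1).pow 2)))).add
    ((SM.const _).mul ((hw.sub hv).pow 2))

lemma SM.comm2 (hU : IsOpen U) (hf : SM U f) (h : (x, t) ∈ U) :
    _root_.pdt (_root_.pdx (_root_.pdx f)) x t = _root_.pdx (_root_.pdx (_root_.pdt f)) x t := by
  rw [(hf.pdx hU).comm hU h]
  exact pdx_congr hU (fun q hq => hf.comm hU hq) h

lemma En_pdt (hU : IsOpen U) (hw : SM U w) (hv : SM U v) (h : (x, t) ∈ U) :
    pdt (En D lam w v) x t =
    ((pdt (pdt w) x t - pdt (pdt v) x t) * (pdt w x t - pdt v x t)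
      + D * (((pdx (pdx w) x t - pdx (pdx v) x t)
          + (pdx w x t ^ 2 * pdx (pdx w) x t - pdx v x t ^ 2 * pdx (pdx v) x t))
          * (pdx (pdx (pdt w)) x t - pdx (pdx (pdt v)) x t))
      + D * ((pdx (pdx w) x t ^ 2 * pdx w x t - pdx (pdx v) x t ^ 2 * pdx v x t)
          * (pdx (pdt w) x t - pdx (pdt v) x t)))
    + (lam * (w x t - v x t) * (pdt w x t - pdt v x t)
      + D * (pdx w x t * pdx (pdt w) x t * (pdx (pdx w) x t - pdx (pdx v) x t) ^ 2
      + ((pdx (pdt w) x t + pdx (pdt v) x t) * pdx (pdx v) x t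
          + (pdx w x t + pdx v x t) * pdx (pdx (pdt v)) x t) * (pdx w x t - pdx v x t)
          * (pdx (pdx w) x t - pdx (pdx v) x t)
      + (pdx v x t * pdx (pdx v) x t - pdx w x t * pdx (pdx w) x t)
          * (pdx (pdx w) x t - pdx (pdx v) x t) * (pdx (pdt w) x t - pdx (pdt v) x t)
      + pdx (pdx v) x t * pdx (pdx (pdt v)) x t * (pdx w x t - pdx v x t) ^ 2)) := by
  have w0 := hw.ht hU h
  have v0 := hv.ht hU h
  have w1 := (hw.pdx hU).ht hU h
  have v1 := (hv.pdx hU).ht hU h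
  have w2 := ((hw.pdx hU).pdx hU).ht hU h
  have v2 := ((hv.pdx hU).pdx hU).ht hU h
  have wt := (hw.pdt hU).ht hU h
  have vt := (hv.pdt hU).ht hU h
  rw [hw.comm hU h] at w1
  rw [hv.comm hU h] at v1
  rw [hw.comm2 hU h] at w2
  rw [hv.comm2 hU h] at v2
  refine HasDerivAt.deriv (f := fun s => En D lam w v x s) ?_
  unfold En
  refine (((((((wt.fun_sub vt).fun_pow 2).const_mul _).fun_add
    ((((w1.fun_pow 2).const_add 1).const_mul (D / 2)).fun_mul ((w2.fun_sub v2).fun_pow 2))).fun_add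
    ((((((w1.fun_add v1).fun_mul v2).fun_mul (w1.fun_sub v1)).fun_mul (w2.fun_sub v2))).const_mul D)).fun_add
    (((v2.fun_pow 2).fun_mul ((w1.fun_sub v1).fun_pow 2)).const_mul (D / 2))).fun_add
    (((w0.fun_sub v0).fun_pow 2).const_mul (lam / 2))).congr_deriv ?_
  simp only [Nat.cast_ofNat, Nat.add_one_sub_one, pow_one]
  ring
end energy

/-- Continuous dependence estimate of Theorem 4.1: for classical solutions of the
stiffness-only system whose relevant derivatives are bounded by `R`, the difference
`z = w - v` satisfies `‖z_t(t)‖² + ‖z_xx(t)‖² ≤ C (‖z_t(0)‖² + ‖z_xx(0)‖²)`,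
with `C` depending only on `R`, `T`, `L`, `D`. -/
theorem stiffness_continuous_dependence
    (L D T R : ℝ) (hL : 0 < L) (hD : 0 < D) (hT : 0 < T) (hR : 0 < R) :
    ∃ C : ℝ, 0 < C ∧
      ∀ p w v : ℝ → ℝ → ℝ,
        ContDiff ℝ (⊤ : ℕ∞) (fun q : ℝ × ℝ => p q.1 q.2) →
        IsStiffSol L D T p w → IsStiffSol L D T p v →
        (∀ x ∈ Icc (0:ℝ) L, ∀ t ∈ Icc (0:ℝ) T,
          |w x t| ≤ R ∧ |pdx w x t| ≤ R ∧ |pdx (pdx w) x t| ≤ R ∧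
            |pdx (pdx (pdx w)) x t| ≤ R ∧
          |pdt w x t| ≤ R ∧ |pdx (pdt w) x t| ≤ R ∧ |pdx (pdx (pdt w)) x t| ≤ R) →
        (∀ x ∈ Icc (0:ℝ) L, ∀ t ∈ Icc (0:ℝ) T,
          |v x t| ≤ R ∧ |pdx v x t| ≤ R ∧ |pdx (pdx v) x t| ≤ R ∧
            |pdx (pdx (pdx v)) x t| ≤ R ∧
          |pdt v x t| ≤ R ∧ |pdx (pdt v) x t| ≤ R ∧ |pdx (pdx (pdt v)) x t| ≤ R) →
        ∀ t ∈ Icc (0:ℝ) T,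
          (let z : ℝ → ℝ → ℝ := fun x t => w x t - v x t
          (∫ x in (0:ℝ)..L, (pdt z x t) ^ 2)
              + (∫ x in (0:ℝ)..L, (pdx (pdx z) x t) ^ 2)
            ≤ C * ((∫ x in (0:ℝ)..L, (pdt z x 0) ^ 2)
              + (∫ x in (0:ℝ)..L, (pdx (pdx z) x 0) ^ 2))) := by
  obtain ⟨M, hM, hinterp⟩ := interp hL (ε := 1 / (32 * R ^ 4)) (by positivity)
  obtain ⟨lam, hlam⟩ : ∃ lam : ℝ, lam = 8 * D * R ^ 4 * M := ⟨_, rfl⟩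
  have hlam0 : 0 ≤ lam := by rw [hlam]; positivity
  obtain ⟨c0, hc0, hc01, hc02⟩ : ∃ c0 : ℝ, 0 < c0 ∧ c0 ≤ 1 / 2 ∧ c0 ≤ D / 8 :=
    ⟨min (1 / 2) (D / 8), by positivity, min_le_left _ _, min_le_right _ _⟩
  obtain ⟨C1, hC1⟩ : ∃ C1 : ℝ, C1 = 1 / 2 + D / 2 * (1 + 3 * R ^ 2) + 6 * D * R ^ 2 * L ^ 2
    + 8 * lam * L ^ 4 := ⟨_, rfl⟩
  have hC1p : 0 < C1 := by rw [hC1]; positivity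
  obtain ⟨K, hK⟩ : ∃ K : ℝ, K = lam / 2 * (1 + 16 * L ^ 4) + 6 * D * R ^ 2 * (1 + 4 * L ^ 2) :=
    ⟨_, rfl⟩
  have hKp : 0 < K := by rw [hK]; positivity
  refine ⟨C1 / c0 * Real.exp (K / c0 * T), by positivity, ?_⟩
  rintro p w v - ⟨⟨Uw, hUw, hUwI, hw⟩, hweq, hwb⟩ ⟨⟨Uv, hUv, hUvI, hv⟩, hveq, hvb⟩ hwR hvR
  obtain ⟨U, hUd⟩ : ∃ U, U = Uw ∩ Uv := ⟨_, rfl⟩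
  have hU : IsOpen U := by rw [hUd]; exact hUw.inter hUv
  have hwU : SM U w := by rw [hUd]; exact ContDiffOn.mono hw inter_subset_left
  have hvU : SM U v := by rw [hUd]; exact ContDiffOn.mono hv inter_subset_right
  have hin : ∀ t ∈ Icc (0 : ℝ) T, ∀ x ∈ Icc (0 : ℝ) L, (x, t) ∈ U := fun t ht x hx => by
    rw [hUd]; exact ⟨hUwI ⟨hx, ht⟩, hUvI ⟨hx, ht⟩⟩
  have zero_mem : (0 : ℝ) ∈ Icc (0 : ℝ) L := ⟨le_rfl, hL.le⟩
  have L_mem : L ∈ Icc (0 : ℝ) L := ⟨hL.le, le_rfl⟩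
  have w1 := hwU.pdx hU
  have v1 := hvU.pdx hU
  have w2 := w1.pdx hU
  have v2 := v1.pdx hU
  have wt := hwU.pdt hU
  have vt := hvU.pdt hU
  -- the four squared norms
  let a : ℝ → ℝ := fun t => ∫ x in (0 : ℝ)..L, (w x t - v x t) ^ 2
  let b : ℝ → ℝ := fun t => ∫ x in (0 : ℝ)..L, (pdx w x t - pdx v x t) ^ 2
  let c : ℝ → ℝ := fun t => ∫ x in (0 : ℝ)..L, (pdx (pdx w) x t - pdx (pdx v) x t) ^ 2
  let d : ℝ → ℝ := fun t => ∫ x in (0 : ℝ)..L, (pdt w x t - pdt v x t) ^ 2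
  let G : ℝ → ℝ := fun t => ∫ x in (0 : ℝ)..L, En D lam w v x t
  have ha : ∀ t, 0 ≤ a t := fun t => intervalIntegral.integral_nonneg hL.le fun x _ => sq_nonneg _
  have hc : ∀ t, 0 ≤ c t := fun t => intervalIntegral.integral_nonneg hL.le fun x _ => sq_nonneg _
  have hd : ∀ t, 0 ≤ d t := fun t => intervalIntegral.integral_nonneg hL.le fun x _ => sq_nonneg _
  have hba : ∀ t ∈ Icc (0 : ℝ) T, b t ≤ 1 / (32 * R ^ 4) * c t + M * a t := fun t ht =>
    hinterp _ _ _ (fun x hx => (hwU.hx hU (hin t ht x hx)).fun_sub (hvU.hx hU (hin t ht x hx)))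
      (fun x hx => (w1.hx hU (hin t ht x hx)).fun_sub (v1.hx hU (hin t ht x hx)))
      ((w2.sub v2).contx (hin t ht)) (by simp [(hwb t ht).1, (hvb t ht).1])
      (by simp [(hwb t ht).2.1, (hvb t ht).2.1])
  have hbc : ∀ t ∈ Icc (0 : ℝ) T, b t ≤ 4 * L ^ 2 * c t := fun t ht =>
    poincare hL (fun x hx => (w1.hx hU (hin t ht x hx)).fun_sub (v1.hx hU (hin t ht x hx)))
      ((w2.sub v2).contx (hin t ht)) (by simp [(hwb t ht).2.1, (hvb t ht).2.1])
  have hab : ∀ t ∈ Icc (0 : ℝ) T, a t ≤ 4 * L ^ 2 * b t := fun t ht =>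
    poincare hL (fun x hx => (hwU.hx hU (hin t ht x hx)).fun_sub (hvU.hx hU (hin t ht x hx)))
      ((w1.sub v1).contx (hin t ht)) (by simp [(hwb t ht).1, (hvb t ht).1])
  have hac : ∀ t ∈ Icc (0 : ℝ) T, a t ≤ 16 * L ^ 4 * c t := fun t ht => by
    have := mul_le_mul_of_nonneg_left (hbc t ht) (by positivity : 0 ≤ 4 * L ^ 2)
    have := hab t ht
    linarith
  have hE : SM U (En D lam w v) := En_SM hU hwU hvU
  have hlow : ∀ t ∈ Icc (0 : ℝ) T, c0 * (d t + c t) ≤ G t := fun t ht => by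
    have h1 := mono4 hL (F := fun x => -En D lam w v x t)
      (-(lam / 2)) (-(1 / 2)) (4 * D * R ^ 4) (-(D / 4))
      (hE.contx (hin t ht)).neg ((hwU.sub hvU).contx (hin t ht)) ((wt.sub vt).contx (hin t ht))
      ((w1.sub v1).contx (hin t ht)) ((w2.sub v2).contx (hin t ht))
      (fun x hx => lower_bound hD (hwR x hx t ht).2.1 (hvR x hx t ht).2.1 (hvR x hx t ht).2.2.1)
    rw [intervalIntegral.integral_neg] at h1
    change -(G t) ≤ -(lam / 2) * a t + -(1 / 2) * d t + 4 * D * R ^ 4 * b t + -(D / 4) * c t at h1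
    have h2 := mul_le_mul_of_nonneg_left (hba t ht) (by positivity : 0 ≤ 4 * D * R ^ 4)
    have h3 : 4 * D * R ^ 4 * (1 / (32 * R ^ 4) * c t + M * a t) = D / 8 * c t + lam / 2 * a t := by
      rw [hlam]; field_simp; ring
    have h4 := mul_le_mul_of_nonneg_right hc01 (hd t)
    have h5 := mul_le_mul_of_nonneg_right hc02 (hc t)
    linarith
  have hup : ∀ t ∈ Icc (0 : ℝ) T, G t ≤ C1 * (d t + c t) := fun t ht => by
    have h1 := mono4 hL (F := fun x => En D lam w v x t)
      (lam / 2) (1 / 2) (3 / 2 * D * R ^ 2) (D / 2 * (1 + 3 * R ^ 2))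
      (hE.contx (hin t ht)) ((hwU.sub hvU).contx (hin t ht)) ((wt.sub vt).contx (hin t ht))
      ((w1.sub v1).contx (hin t ht)) ((w2.sub v2).contx (hin t ht))
      (fun x hx => upper_bound hD (hwR x hx t ht).2.1 (hvR x hx t ht).2.1 (hvR x hx t ht).2.2.1)
    change G t ≤ lam / 2 * a t + 1 / 2 * d t + 3 / 2 * D * R ^ 2 * b t
      + D / 2 * (1 + 3 * R ^ 2) * c t at h1
    have h2 := mul_le_mul_of_nonneg_left (hbc t ht) (by positivity : 0 ≤ 3 / 2 * D * R ^ 2)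
    have h3 := mul_le_mul_of_nonneg_left (hac t ht) (by positivity : 0 ≤ lam / 2)
    have h4 : 0 ≤ (C1 - 1 / 2) * d t := mul_nonneg (by
      rw [hC1]; ring_nf; positivity) (hd t)
    have h5 : C1 * c t = (1 / 2 + D / 2 * (1 + 3 * R ^ 2) + 6 * D * R ^ 2 * L ^ 2
      + 8 * lam * L ^ 4) * c t := by rw [hC1]
    have := hc t
    linarith
  have hG : ∀ t ∈ Icc (0 : ℝ) T,
      HasDerivAt G (∫ x in (0 : ℝ)..L, pdt (En D lam w v) x t) t := fun t ht =>
    hE.leibniz hU hL (hin t ht)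
  have hder : ∀ t ∈ Ioo (0 : ℝ) T,
      (∫ x in (0 : ℝ)..L, pdt (En D lam w v) x t) ≤ K * (d t + c t) := fun t ht' => by
    have ht : t ∈ Icc (0 : ℝ) T := Ioo_subset_Icc_self ht'
    have hI := hin t ht
    have hnear : ∀ᶠ s in nhds t, s ∈ Icc (0 : ℝ) T := Icc_mem_nhds ht'.1 ht'.2
    have zt : ∀ f : ℝ → ℝ → ℝ, (∀ s ∈ Icc (0 : ℝ) T, f 0 s = 0) → pdt f 0 t = 0 := fun f hf => by
      have : (fun s => f 0 s) =ᶠ[nhds t] fun _ => (0 : ℝ) := by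
        filter_upwards [hnear] with s hs using hf s hs
      unfold pdt
      rw [this.deriv_eq]; simp
    have wA : SM U (fun y s => (pdx w y s) ^ 2 * pdx (pdx w) y s) := (w1.pow 2).mul w2
    have vA : SM U (fun y s => (pdx v y s) ^ 2 * pdx (pdx v) y s) := (v1.pow 2).mul v2
    have wB : SM U (fun y s => (pdx (pdx w) y s) ^ 2 * pdx w y s) := (w2.pow 2).mul w1
    have vB : SM U (fun y s => (pdx (pdx v) y s) ^ 2 * pdx v y s) := (v2.pow 2).mul v1
    have AL : ∀ f : ℝ → ℝ → ℝ, SM U f → pdx (pdx f) L t = 0 → pdx (pdx (pdx f)) L t = 0 →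
        pdx (fun y s => (pdx f y s) ^ 2 * pdx (pdx f) y s) L t = 0 := fun f hf h2 h3 => by
      have e1 := (hf.pdx hU).hx hU (hI L L_mem)
      have e2 := ((hf.pdx hU).pdx hU).hx hU (hI L L_mem)
      have := ((e1.fun_pow 2).fun_mul e2).deriv
      simp only [h2, h3, mul_zero, add_zero] at this
      exact this
    obtain ⟨_, wb1, wb2, wb3⟩ := hwb t ht
    obtain ⟨_, vb1, vb2, vb3⟩ := hvb t ht
    obtain ⟨fc, fi⟩ := flux1D hL (D := D)
      (A := fun x => (pdx (pdx w) x t - pdx (pdx v) x t)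
          + (pdx w x t ^ 2 * pdx (pdx w) x t - pdx v x t ^ 2 * pdx (pdx v) x t))
      (B := fun x => pdx (pdx w) x t ^ 2 * pdx w x t - pdx (pdx v) x t ^ 2 * pdx v x t)
      (φ := fun x => pdt w x t - pdt v x t)
      (q := fun x => pdt (pdt w) x t - pdt (pdt v) x t)
      (fun x hx => ((w2.hx hU (hI x hx)).fun_sub (v2.hx hU (hI x hx))).fun_add
        ((wA.hx hU (hI x hx)).fun_sub (vA.hx hU (hI x hx))))
      (fun x hx => (((w2.pdx hU).hx hU (hI x hx)).fun_sub ((v2.pdx hU).hx hU (hI x hx))).fun_add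
        (((wA.pdx hU).hx hU (hI x hx)).fun_sub ((vA.pdx hU).hx hU (hI x hx))))
      (fun x hx => (wB.hx hU (hI x hx)).fun_sub (vB.hx hU (hI x hx)))
      (fun x hx => (wt.hx hU (hI x hx)).fun_sub (vt.hx hU (hI x hx)))
      (fun x hx => ((wt.pdx hU).hx hU (hI x hx)).fun_sub ((vt.pdx hU).hx hU (hI x hx)))
      ((((wt.pdx hU).pdx hU).sub ((vt.pdx hU).pdx hU)).contx hI)
      (((wt.pdt hU).sub (vt.pdt hU)).contx hI)
      (fun x hx => by
        have e1 := hweq x hx t ht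
        have e2 := hveq x hx t ht
        unfold stiffOp at e1 e2
        linarith)
      (by simp only [zt w fun s hs => (hwb s hs).1, zt v fun s hs => (hvb s hs).1, sub_zero])
      (by
        simp only [← hwU.comm hU (hI 0 zero_mem), ← hvU.comm hU (hI 0 zero_mem),
          zt (pdx w) fun s hs => (hwb s hs).2.1, zt (pdx v) fun s hs => (hvb s hs).2.1, sub_zero])
      (by simp [wb2, vb2])
      (by simp only [wb3, vb3, AL w hwU wb2 wb3, AL v hvU vb2 vb3, sub_zero, add_zero])
      (by simp [wb2, vb2])
    have Ec := (hE.pdt hU).contx hI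
    have h1 := mono4 hL (lam / 2) (lam / 2) (6 * D * R ^ 2) (6 * D * R ^ 2) (Ec.sub fc)
      ((hwU.sub hvU).contx hI) ((wt.sub vt).contx hI)
      ((w1.sub v1).contx hI) ((w2.sub v2).contx hI)
      (fun x hx => by
        obtain ⟨-, r1, r2, -, -, r3, r4⟩ := hwR x hx t ht
        obtain ⟨-, s1, s2, -, -, s3, s4⟩ := hvR x hx t ht
        have h := rest_bound (z := w x t - v x t) (zt := pdt w x t - pdt v x t)
          hD hlam0 r1 s1 r2 s2 r3 s3 r4 s4
        refine le_trans (le_of_eq ?_) h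
        simp only [Pi.sub_apply]
        rw [En_pdt hU hwU hvU (hI x hx), add_sub_cancel_left])
    simp only [Pi.sub_apply] at h1
    rw [intervalIntegral.integral_sub (ii hL Ec) (ii hL fc), fi, sub_zero] at h1
    change _ ≤ lam / 2 * a t + lam / 2 * d t + 6 * D * R ^ 2 * b t + 6 * D * R ^ 2 * c t at h1
    have h2 := mul_le_mul_of_nonneg_left (hbc t ht) (by positivity : 0 ≤ 6 * D * R ^ 2)
    have h3 := mul_le_mul_of_nonneg_left (hac t ht) (by positivity : 0 ≤ lam / 2)
    have h4 : 0 ≤ (K - lam / 2) * d t := mul_nonneg (by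
      rw [hK]; ring_nf; positivity) (hd t)
    have h5 : K * c t = (lam / 2 * (1 + 16 * L ^ 4) + 6 * D * R ^ 2 * (1 + 4 * L ^ 2)) * c t := by
      rw [hK]
    have h6 : 0 ≤ lam / 2 * c t := mul_nonneg (by positivity) (hc t)
    linarith
  -- Gronwall
  have hanti : AntitoneOn (fun t => Real.exp (-(K / c0 * t)) * G t) (Icc 0 T) := by
    have hH : ∀ t ∈ Icc (0 : ℝ) T, HasDerivAt (fun t => Real.exp (-(K / c0 * t)) * G t)
        (Real.exp (-(K / c0 * t)) * ((∫ x in (0 : ℝ)..L, pdt (En D lam w v) x t) - K / c0 * G t)) t :=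
      fun t ht => by
        have e1 : HasDerivAt (fun t : ℝ => -(K / c0 * t)) (-(K / c0 * 1)) t :=
          ((hasDerivAt_id t).const_mul (K / c0)).neg
        exact (e1.exp.fun_mul (hG t ht)).congr_deriv (by ring)
    refine antitoneOn_of_deriv_nonpos (convex_Icc 0 T)
      (fun t ht => (hH t ht).continuousAt.continuousWithinAt)
      (fun t ht => (hH t (interior_subset ht)).differentiableAt.differentiableWithinAt) ?_
    intro t ht
    rw [(hH t (interior_subset ht)).deriv]
    rw [interior_Icc] at ht
    refine mul_nonpos_of_nonneg_of_nonpos (Real.exp_pos _).le ?_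
    have h1 := hder t ht
    have h2 := mul_le_mul_of_nonneg_left (hlow t (Ioo_subset_Icc_self ht))
      (by positivity : 0 ≤ K / c0)
    have h3 : K / c0 * (c0 * (d t + c t)) = K * (d t + c t) := by field_simp
    linarith
  have zpdt : ∀ q ∈ U, pdt (fun x t => w x t - v x t) q.1 q.2 = pdt w q.1 q.2 - pdt v q.1 q.2 :=
    fun q hq => ((hwU.ht hU hq).fun_sub (hvU.ht hU hq)).deriv
  have zpdx : ∀ q ∈ U, pdx (fun x t => w x t - v x t) q.1 q.2 = pdx w q.1 q.2 - pdx v q.1 q.2 :=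
    fun q hq => ((hwU.hx hU hq).fun_sub (hvU.hx hU hq)).deriv
  have zpdxx : ∀ q ∈ U, pdx (pdx (fun x t => w x t - v x t)) q.1 q.2
      = pdx (pdx w) q.1 q.2 - pdx (pdx v) q.1 q.2 := fun q hq => by
    rw [pdx_congr hU (g := fun x t => pdx w x t - pdx v x t) zpdx hq]
    exact ((w1.hx hU hq).fun_sub (v1.hx hU hq)).deriv
  have hdz : ∀ t ∈ Icc (0 : ℝ) T,
      ∫ x in (0 : ℝ)..L, (pdt (fun x t => w x t - v x t) x t) ^ 2 = d t := fun t ht => by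
    refine intervalIntegral.integral_congr fun x hx => ?_
    rw [uIcc_of_le hL.le] at hx
    exact congrArg (fun r : ℝ => r ^ 2) (zpdt _ (hin t ht x hx))
  have hcz : ∀ t ∈ Icc (0 : ℝ) T,
      ∫ x in (0 : ℝ)..L, (pdx (pdx (fun x t => w x t - v x t)) x t) ^ 2 = c t := fun t ht => by
    refine intervalIntegral.integral_congr fun x hx => ?_
    rw [uIcc_of_le hL.le] at hx
    exact congrArg (fun r : ℝ => r ^ 2) (zpdxx _ (hin t ht x hx))
  intro t ht
  have h0 : (0 : ℝ) ∈ Icc (0 : ℝ) T := ⟨le_rfl, hT.le⟩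
  simp only
  rw [hdz t ht, hcz t ht, hdz 0 h0, hcz 0 h0]
  have g1 := hanti h0 ht ht.1
  simp only [mul_zero, neg_zero, Real.exp_zero, one_mul] at g1
  have g2 : G t ≤ Real.exp (K / c0 * t) * G 0 := by
    have := mul_le_mul_of_nonneg_left g1 (Real.exp_pos (K / c0 * t)).le
    rwa [← mul_assoc, ← Real.exp_add, add_neg_cancel, Real.exp_zero, one_mul] at this
  have hN0 : 0 ≤ d 0 + c 0 := add_nonneg (hd 0) (hc 0)
  have g3 : Real.exp (K / c0 * t) * G 0 ≤ Real.exp (K / c0 * T) * (C1 * (d 0 + c 0)) := by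
    refine (mul_le_mul_of_nonneg_left (hup 0 h0) (Real.exp_pos _).le).trans ?_
    refine mul_le_mul_of_nonneg_right (Real.exp_le_exp.2 ?_) (by positivity)
    exact mul_le_mul_of_nonneg_left ht.2 (by positivity)
  have g4 := hlow t ht
  have g5 : c0 * (d t + c t) ≤ Real.exp (K / c0 * T) * (C1 * (d 0 + c 0)) := by linarith
  have g6 : C1 / c0 * Real.exp (K / c0 * T) * (d 0 + c 0)
      = (Real.exp (K / c0 * T) * (C1 * (d 0 + c 0))) / c0 := by ring
  rw [g6, le_div_iff₀ hc0]
  linarith
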